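/- Let M_1, M_2, N_1, N_2 be finite-dimensional A-modules and let f : M_1 → N_1 and g : M_2 → N_2 be homomorphisms. If the direct-sum map f ⊕ g : M_1 ⊕ M_2 → N_1 ⊕ N_2 satisfies rank(f ⊕ g) = r(M_1 ⊕ M_2, N_1 ⊕ N_2), then rank(f) = r(M_1, N_1) and rank(g) = r(M_2, N_2). -/

import Mathlib

/-- The rank of an `A`-linear map between modules over a `K`-algebra `A`:
the `K`-dimension of its image. -/
noncomputable def rk (K : Type*) [Field K] {A : Type*} [Ring A] [Algebra K A]
    {M N : Type*} [AddCommGroup M] [Module A M]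
    [AddCommGroup N] [Module A N] [Module K N] [IsScalarTower K A N]
    (f : M →ₗ[A] N) : ℕ :=
  Module.finrank K ((LinearMap.range f).restrictScalars K)

/-- `rmax K A M N` is `r(M,N)`, the maximal rank of an `A`-linear map `M → N`. -/
noncomputable def rmax (K : Type*) [Field K] (A : Type*) [Ring A] [Algebra K A]
    (M N : Type*) [AddCommGroup M] [Module A M]
    [AddCommGroup N] [Module A N] [Module K N] [IsScalarTower K A N] : ℕ :=
  sSup {n : ℕ | ∃ f : M →ₗ[A] N, rk K f = n}

theorem finrank_submodule_prod {K V W : Type*} [Field K] [AddCommGroup V] [Module K V]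
    [FiniteDimensional K V] [AddCommGroup W] [Module K W] [FiniteDimensional K W]
    (p : Submodule K V) (q : Submodule K W) :
    Module.finrank K (p.prod q) = Module.finrank K p + Module.finrank K q := by
  let e : (p.prod q) ≃ₗ[K] p × q :=
    { toFun := fun x => (⟨x.1.1, x.2.1⟩, ⟨x.1.2, x.2.2⟩)
      invFun := fun x => ⟨(x.1.1, x.2.1), x.1.2, x.2.2⟩
      map_add' := fun _ _ => rfl
      map_smul' := fun _ _ => rfl
      left_inv := fun _ => rfl
      right_inv := fun _ => rfl }
  rw [e.finrank_eq, Module.finrank_prod]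

section RankLemmas

variable {K A : Type*} [Field K] [Ring A] [Algebra K A]
  {M M' N N' : Type*}
  [AddCommGroup M] [Module A M] [AddCommGroup M'] [Module A M']
  [AddCommGroup N] [Module A N] [Module K N] [IsScalarTower K A N] [FiniteDimensional K N]
  [AddCommGroup N'] [Module A N'] [Module K N'] [IsScalarTower K A N'] [FiniteDimensional K N']

theorem rk_le_rmax (f : M →ₗ[A] N) : rk K f ≤ rmax K A M N := by
  refine le_csSup ⟨Module.finrank K N, ?_⟩ ⟨f, rfl⟩
  rintro _ ⟨f, rfl⟩
  exact Submodule.finrank_le _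

theorem exists_rk_eq_rmax : ∃ f : M →ₗ[A] N, rk K f = rmax K A M N := by
  refine Nat.sSup_mem (s := {n : ℕ | ∃ f : M →ₗ[A] N, rk K f = n}) ⟨_, 0, rfl⟩
    ⟨Module.finrank K N, ?_⟩
  rintro _ ⟨f, rfl⟩
  exact Submodule.finrank_le _

theorem rk_prodMap (f : M →ₗ[A] N) (g : M' →ₗ[A] N') :
    rk K (LinearMap.prodMap f g) = rk K f + rk K g := by
  have h : (LinearMap.range (LinearMap.prodMap f g)).restrictScalars K =
      ((LinearMap.range f).restrictScalars K).prod ((LinearMap.range g).restrictScalars K) := by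
    rw [LinearMap.range_prodMap]
    rfl
  unfold rk
  rw [h, finrank_submodule_prod]

end RankLemmas

theorem stmt6 {K A : Type*} [Field K] [IsAlgClosed K] [Ring A] [Algebra K A]
    [FiniteDimensional K A]
    {M₁ M₂ N₁ N₂ : Type*}
    [AddCommGroup M₁] [Module A M₁] [Module K M₁] [IsScalarTower K A M₁] [FiniteDimensional K M₁]
    [AddCommGroup M₂] [Module A M₂] [Module K M₂] [IsScalarTower K A M₂] [FiniteDimensional K M₂]
    [AddCommGroup N₁] [Module A N₁] [Module K N₁] [IsScalarTower K A N₁] [FiniteDimensional K N₁]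
    [AddCommGroup N₂] [Module A N₂] [Module K N₂] [IsScalarTower K A N₂] [FiniteDimensional K N₂]
    (f : M₁ →ₗ[A] N₁) (g : M₂ →ₗ[A] N₂)
    (h : rk K (LinearMap.prodMap f g) = rmax K A (M₁ × M₂) (N₁ × N₂)) :
    rk K f = rmax K A M₁ N₁ ∧ rk K g = rmax K A M₂ N₂ := by
  obtain ⟨f', hf'⟩ := exists_rk_eq_rmax (K := K) (A := A) (M := M₁) (N := N₁)
  obtain ⟨g', hg'⟩ := exists_rk_eq_rmax (K := K) (A := A) (M := M₂) (N := N₂)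
  have hmax := rk_le_rmax (K := K) (LinearMap.prodMap f' g')
  have hf := rk_le_rmax (K := K) f
  have hg := rk_le_rmax (K := K) g
  rw [rk_prodMap] at h hmax
  omega
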